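/- Let u be an internal node of T with left child v. Then A_d(v) + d(u,v) > B. (Interpretation: any walk from the root that reaches v and then backtracks over the left edge (u,v) travels a total distance exceeding the budget B; hence no non-adaptive policy can backtrack over any left-branching edge.) -/

import Mathlib

namespace StocOrient

/-- State along a root-to-node walk in the tree `T`:
current node's size `sz`, residual budget `bu`, distance traveled `dist`
(i.e. `A_d`), and size instantiated `inst` (i.e. `A_s`). -/
structure St where
  sz : ℚ
  bu : ℚ
  dist : ℚ
  inst : ℚ

/-- One step from a node at level `lvl` to one of its children
(`true` = right child, `false` = left child); the child is at level `lvl - 1`. -/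
def step (lvl : ℕ) (x : St) (dir : Bool) : St :=
  if dir then
    { sz := x.sz * (2 : ℚ) ^ ((2 : ℤ) ^ (lvl - 1)),
      bu := x.bu - x.sz,
      dist := x.dist,
      inst := x.inst + x.sz }
  else
    { sz := x.sz * (2 : ℚ) ^ (-((2 : ℤ) ^ (lvl - 1))),
      bu := x.sz,
      dist := x.dist + (x.bu - x.sz),
      inst := x.inst }

def walkAux : ℕ → St → List Bool → St
  | _, x, [] => x
  | lvl, x, d :: rest => walkAux (lvl - 1) (step lvl x d) rest

/-- The budget `B = 2^(2^(L+1))`. -/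
def Bq (L : ℕ) : ℚ := 2 ^ 2 ^ (L + 1)

/-- Data at the root: `s_ρ = 2^(2^L)`, `b(ρ) = B`, `A_d(ρ) = A_s(ρ) = 0`. -/
def start (L : ℕ) : St := ⟨2 ^ 2 ^ L, Bq L, 0, 0⟩

/-- A node of the tree `T` is identified with its root-to-node path
(`true` = right branch); nodes of `T` are exactly the paths of length `< L`. -/
def walk (L : ℕ) (v : List Bool) : St := walkAux L (start L) v

/-- The size `s_v`. -/
def size (L : ℕ) (v : List Bool) : ℚ := (walk L v).sz

/-- The residual budget `b(v)`. -/
def budget (L : ℕ) (v : List Bool) : ℚ := (walk L v).bu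

/-- `A_d(v)`: total edge length on the root-to-`v` path. -/
def Ad (L : ℕ) (v : List Bool) : ℚ := (walk L v).dist

/-- `A_s(v)`: total size of strict ancestors of `v` from which the path to `v`
goes right. -/
def As (L : ℕ) (v : List Bool) : ℚ := (walk L v).inst

/-- The level `ℓ(v)`: the root is at level `L`, the leaves at level `1`. -/
def level (L : ℕ) (v : List Bool) : ℕ := L - v.length

end StocOrient

open StocOrient

/-- The invariant kept along the root-to-node walk at a node of level `lvl`. -/
structure WalkInvariant (B : ℚ) (lvl : ℕ) (x : St) : Prop where
  sz_pos : 0 < x.sz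
  inst_nonneg : 0 ≤ x.inst
  inst_le : x.inst * 2 ^ 2 ^ lvl ≤ 2 * x.sz
  gap_le : (2 ^ 2 ^ lvl - 1) * x.sz ≤ x.bu - x.inst
  total : x.dist + x.inst + x.bu = B

lemma two_zpow_two_zpow (n : ℕ) : (2 : ℚ) ^ ((2 : ℤ) ^ n) = 2 ^ 2 ^ n := by
  exact_mod_cast zpow_natCast (2 : ℚ) (2 ^ n)

lemma pow_le_two_pow_two_pow {k n : ℕ} (h : k ≤ n) : (2 : ℚ) ^ 2 ^ k ≤ 2 ^ 2 ^ n :=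
  pow_le_pow_right₀ one_le_two (pow_le_pow_right₀ one_le_two h)

lemma WalkInvariant.step {B : ℚ} {n : ℕ} {x : St} (hn : 1 ≤ n)
    (h : WalkInvariant B (n + 1) x) (d : Bool) :
    WalkInvariant B n (StocOrient.step (n + 1) x d) := by
  obtain ⟨hs, hi, hle, hgap, htot⟩ := h
  have hD : (4 : ℚ) ≤ 2 ^ 2 ^ n := by
    simpa [show (2 : ℚ) ^ 2 = 4 by norm_num] using pow_le_two_pow_two_pow hn
  rw [pow_succ 2 n, pow_mul] at hle hgap
  have hz := two_zpow_two_zpow n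
  obtain ⟨D, hp⟩ : ∃ D : ℚ, 2 ^ 2 ^ n = D := ⟨_, rfl⟩
  rw [hp] at hle hgap hD hz
  have hD0 : 0 < D := by linarith
  cases d
  · obtain ⟨t, ht⟩ : ∃ t, t = x.sz * D⁻¹ := ⟨_, rfl⟩
    have hst : x.sz = t * D := by rw [ht]; field_simp
    have ht0 : 0 < t := ht ▸ by positivity
    have hit : x.inst * D ≤ 2 * t := by
      refine le_of_mul_le_mul_right ?_ hD0
      nlinarith
    constructor <;>
      simp only [StocOrient.step, Nat.add_sub_cancel, zpow_neg, hz, hp, ← ht, Bool.false_eq_true,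
        if_false]
    · exact ht0
    · exact hi
    · exact hit
    · have : x.inst ≤ t := by nlinarith
      linarith
    · linarith
  · have his : x.inst ≤ x.sz := by nlinarith [mul_nonneg hi (by nlinarith : 0 ≤ D ^ 2 - 2)]
    constructor <;> simp only [StocOrient.step, Nat.add_sub_cancel, hz, hp, if_true]
    · positivity
    · linarith
    · nlinarith
    · nlinarith [mul_nonneg hs.le (by linarith : 0 ≤ D - 3)]
    · linarith

lemma WalkInvariant.walkAux {B : ℚ} (u : List Bool) {l : ℕ} {x : St} (hu : u.length + 1 < l)
    (h : WalkInvariant B l x) :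
    WalkInvariant B (l - u.length) (StocOrient.walkAux l x u) := by
  induction u generalizing l x with
  | nil => exact h
  | cons d u ih =>
    obtain ⟨n, rfl⟩ : ∃ n, l = n + 1 := ⟨l - 1, by omega⟩
    rw [List.length_cons] at hu ⊢
    have := ih (l := n) (by omega) (h.step (by omega) d)
    rwa [Nat.add_sub_add_right]

lemma walkInvariant_start (L : ℕ) : WalkInvariant (Bq L) L (start L) := by
  constructor <;> simp only [start, Bq]
  · positivity
  · exact le_rfl
  · rw [zero_mul]; positivity
  · rw [pow_succ 2 L, pow_mul]
    nlinarith [show (0 : ℚ) < 2 ^ 2 ^ L by positivity]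
  · ring

lemma walkAux_append (u v : List Bool) (l : ℕ) (x : St) :
    walkAux l x (u ++ v) = walkAux (l - u.length) (walkAux l x u) v := by
  induction u generalizing l x with
  | nil => rfl
  | cons d u ih =>
    simp only [List.cons_append, walkAux, ih, List.length_cons]
    congr 1
    omega

lemma Ad_append_false (L : ℕ) (u : List Bool) :
    Ad L (u ++ [false]) = Ad L u + (budget L u - size L u) := by
  simp [Ad, budget, size, walk, walkAux_append, walkAux, step]

/-- For an internal node `u` with left child `v = u ++ [false]`,
`A_d(v) + d(u,v) > B`: no non-adaptive policy can backtrack over a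
left-branching edge (whose length is `d(u,v) = b(u) - s_u`). -/
theorem stmt10 (L : ℕ) (hL : 2 ≤ L) (u : List Bool) (hu : u.length + 1 < L) :
    Bq L < Ad L (u ++ [false]) + (budget L u - size L u) := by
  obtain ⟨hs, hi, -, hgap, htot⟩ := (walkInvariant_start L).walkAux u hu
  have hD : (16 : ℚ) ≤ 2 ^ 2 ^ (L - u.length) := by
    simpa [show (2 : ℚ) ^ 4 = 16 by norm_num] using
      pow_le_two_pow_two_pow (show 2 ≤ L - u.length by omega)
  rw [Ad_append_false]
  simp only [Ad, budget, size, walk]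
  nlinarith
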